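/- Let p be a prime and R a commutative ring of characteristic p which is reduced and on which the Frobenius endomorphism x ↦ x^p is surjective (for instance, R a perfect ring of characteristic p). Then the ring homomorphism 𝓕 : R[[z]] → R[[z]]^F, sending a power series with coefficient sequence (a_n)_{n∈ℕ} to the sequence (a_n^{p^n})_{n∈ℕ}, is bijective, i.e. a ring isomorphism. -/

import Mathlib

/-- The map `𝓕 : R[[z]] → R[[z]]^F`, sending a power series with coefficients `(a_n)` to the
sequence `(a_n^{p^n})`. -/
noncomputable def frobTwist (p : ℕ) {R : Type*} [CommRing R] (a : PowerSeries R) : ℕ → R :=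
  fun n => (PowerSeries.coeff n a) ^ p ^ n

/-- If `R` is a reduced commutative ring of characteristic `p` on which the Frobenius
endomorphism `x ↦ x^p` is surjective, then the ring homomorphism
`𝓕 : R[[z]] → R[[z]]^F`, `(a_n) ↦ (a_n^{p^n})`, is bijective, i.e. a ring isomorphism onto
the ring of Frobenius-twisted power series. -/
theorem frobTwist_bijective (p : ℕ) (hp : p.Prime) (R : Type*) [CommRing R] [CharP R p]
    (hred : IsReduced R) (hsurj : Function.Surjective fun x : R => x ^ p) :
    Function.Bijective (frobTwist p (R := R)) := by
  haveI : Fact p.Prime := ⟨hp⟩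
  haveI : ExpChar R p := ExpChar.prime hp
  have hb : Function.Bijective (frobenius R p) := ⟨frobenius_inj R p, hsurj⟩
  have hit : ∀ n : ℕ, Function.Bijective fun x : R => x ^ p ^ n := by
    intro n
    have h := hb.iterate n
    rwa [← coe_iterateFrobenius] at h
  constructor
  · intro a b hab
    ext n
    exact (hit n).1 (congrFun hab n)
  · intro b
    choose c hc using fun n => (hit n).2 (b n)
    refine ⟨PowerSeries.mk c, ?_⟩
    funext n
    simpa [frobTwist] using hc n
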